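/- arXiv:1508.01951 — 4 statements merged into one kernel-verified Lean document; each statement's English description precedes it below -/
import Mathlib

section
/- Let V be a finite set, f : Finset V → ℝ a nonnegative set function, c : V → ℝ a cost function with 0 < c(v) for all v, B > 0 a budget, and Opt ⊆ V a set with f(Opt) ≥ 0. Let γ ∈ (0,1), and let v_1, …, v_l be distinct elements of V with partial solutions S_0 = ∅ and S_i = S_{i−1} ∪ {v_i}, satisfying: (a) c(v_i) ≤ B for every i; (b) the greedy per-step guarantee f(S_i) − f(S_{i−1}) ≥ (c(v_i)/B) · ( f(Opt) − f(S_{i−1}) ) for every i = 1,…,l; and (c) the total spent cost satisfies ∑_{j=1}^{l} c(v_j) ≥ (1 − γ) · B. Then f(S_l) ≥ (1 − e^{−(1−γ)}) · f(Opt). -/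
/-- A sequence that closes at least a fraction `x i ≤ 1` of its gap to `M` at step `i`
ends with a gap of at most `exp (-∑ i, x i) * M`. -/
theorem sub_last_le_exp_neg_sum_mul {M : ℝ} (hM : 0 ≤ M) (n : ℕ) (x : Fin n → ℝ)
    (a : Fin (n + 1) → ℝ) (ha : 0 ≤ a 0) (hx : ∀ i, x i ≤ 1)
    (h : ∀ i : Fin n, x i * (M - a i.castSucc) ≤ a i.succ - a i.castSucc) :
    M - a (Fin.last n) ≤ Real.exp (-∑ i, x i) * M := by
  induction n with
  | zero => simpa using ha
  | succ n ih =>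
    have hprev := ih (fun i => x i.castSucc) (fun i => a i.castSucc) ha
      (fun i => hx i.castSucc) (fun i => h i.castSucc)
    have hstep := h (Fin.last n)
    rw [Fin.succ_last] at hstep
    have hexp := Real.one_sub_le_exp_neg (x (Fin.last n))
    calc
      M - a (Fin.last (n + 1))
          ≤ (1 - x (Fin.last n)) * (M - a (Fin.last n).castSucc) := by linarith
      _ ≤ (1 - x (Fin.last n)) * (Real.exp (-∑ i : Fin n, x i.castSucc) * M) :=
          mul_le_mul_of_nonneg_left hprev (sub_nonneg.2 (hx _))
      _ ≤ Real.exp (-x (Fin.last n)) * (Real.exp (-∑ i : Fin n, x i.castSucc) * M) := by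
          gcongr
      _ = Real.exp (-∑ i, x i) * M := by
          rw [Fin.sum_univ_castSucc, neg_add, Real.exp_add]
          ring

/-- Theorem 2 (analytic core): greedy crowd access optimization with per-step
guarantee and spent budget at least `(1 - γ) * B` achieves utility at least
`(1 - e^{-(1-γ)})` times that of the optimal plan. -/
theorem greedy_crowd_access_bound {V : Type*} [DecidableEq V]
    (f : Finset V → ℝ) (hf : ∀ S : Finset V, 0 ≤ f S)
    (c : V → ℝ) (hc : ∀ v : V, 0 < c v)
    (B : ℝ) (hB : 0 < B)
    (Opt : Finset V) (hOpt : 0 ≤ f Opt)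
    (γ : ℝ) (hγ : γ ∈ Set.Ioo (0 : ℝ) 1)
    (l : ℕ) (v : Fin l → V) (hv : Function.Injective v)
    (S : Fin (l + 1) → Finset V)
    (hS0 : S 0 = ∅)
    (hSstep : ∀ i : Fin l, S i.succ = insert (v i) (S i.castSucc))
    (hcB : ∀ i : Fin l, c (v i) ≤ B)
    (hgreedy : ∀ i : Fin l,
      f (S i.succ) - f (S i.castSucc) ≥ (c (v i) / B) * (f Opt - f (S i.castSucc)))
    (hspent : (1 - γ) * B ≤ ∑ i : Fin l, c (v i)) :
    f (S (Fin.last l)) ≥ (1 - Real.exp (-(1 - γ))) * f Opt := by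
  have hgap := sub_last_le_exp_neg_sum_mul hOpt l (fun i => c (v i) / B) (fun i => f (S i))
    (hf _) (fun i => (div_le_one hB).2 (hcB i)) hgreedy
  have hfrac : 1 - γ ≤ ∑ i, c (v i) / B := by
    rwa [← Finset.sum_div, le_div_iff₀ hB]
  have hexp : Real.exp (-∑ i, c (v i) / B) * f Opt ≤ Real.exp (-(1 - γ)) * f Opt := by
    gcongr
  linarith
end

section
/- Let V be a finite set, f : Finset V → ℝ a monotone submodular set function, c : V → ℝ with c(v) > 0 for all v, B > 0, and Opt ⊆ V with ∑_{v ∈ Opt} c(v) ≤ B. Let S ⊆ V be a finite set and suppose v* ∈ V ∖ S satisfies the greedy benefit–cost optimality condition ( f(S ∪ {v*}) − f(S) ) / c(v*) ≥ ( f(S ∪ {v}) − f(S) ) / c(v) for every v ∈ Opt ∖ S. Then f(S ∪ {v*}) − f(S) ≥ ( c(v*) / B ) · ( f(Opt) − f(S) ). -/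
/-- For a submodular set function, the joint gain of adding `T` to a disjoint set `S` is at most the
sum of the gains of adding the elements of `T` one by one to `S`. -/
theorem submodular_union_sub_le_sum {V : Type*} [DecidableEq V] {f : Finset V → ℝ}
    (hsub : ∀ S T : Finset V, S ⊆ T → ∀ v ∉ T,
      f (insert v S) - f S ≥ f (insert v T) - f T)
    {S T : Finset V} (hST : Disjoint S T) :
    f (S ∪ T) - f S ≤ ∑ v ∈ T, (f (insert v S) - f S) := by
  induction T using Finset.induction_on with
  | empty => simp
  | insert a T ha ih =>
    obtain ⟨haS, hST⟩ := Finset.disjoint_insert_right.mp hST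
    have hstep := hsub S (S ∪ T) Finset.subset_union_left a (by simp [haS, ha])
    rw [Finset.sum_insert ha, Finset.union_insert]
    linarith [ih hST]

/-- Per-step guarantee of greedy benefit–cost selection: if `v*` maximizes the
marginal-gain-per-cost ratio over the elements of `Opt \ S`, then adding `v*`
closes at least a `c v* / B` fraction of the gap to the optimum value. -/
theorem greedy_per_step_guarantee {V : Type*} [DecidableEq V]
    (f : Finset V → ℝ)
    (hmono : ∀ S T : Finset V, S ⊆ T → f S ≤ f T)
    (hsub : ∀ S T : Finset V, S ⊆ T → ∀ v ∉ T,
      f (insert v S) - f S ≥ f (insert v T) - f T)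
    (c : V → ℝ) (hc : ∀ v : V, 0 < c v)
    (B : ℝ) (hB : 0 < B)
    (Opt : Finset V) (hOptc : ∑ v ∈ Opt, c v ≤ B)
    (S : Finset V) (vstar : V) (hvstar : vstar ∉ S)
    (hbc : ∀ v ∈ Opt \ S,
      (f (insert vstar S) - f S) / c vstar ≥ (f (insert v S) - f S) / c v) :
    f (insert vstar S) - f S ≥ (c vstar / B) * (f Opt - f S) := by
  set r := (f (insert vstar S) - f S) / c vstar with hr
  have hr0 : 0 ≤ r :=
    div_nonneg (sub_nonneg.mpr (hmono _ _ (Finset.subset_insert _ _))) (hc vstar).le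
  have hgain : f (insert vstar S) - f S = c vstar * r := by
    rw [hr, mul_div_cancel₀ _ (hc vstar).ne']
  have hgap : f Opt - f S ≤ r * B := calc
    f Opt - f S ≤ f (S ∪ Opt \ S) - f S := by
      rw [Finset.union_sdiff_self_eq_union]
      exact sub_le_sub_right (hmono _ _ Finset.subset_union_right) _
    _ ≤ ∑ v ∈ Opt \ S, (f (insert v S) - f S) :=
      submodular_union_sub_le_sum hsub Finset.disjoint_sdiff
    _ ≤ ∑ v ∈ Opt \ S, r * c v :=
      Finset.sum_le_sum fun v hv => (div_le_iff₀ (hc v)).mp (hbc v hv)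
    _ = r * ∑ v ∈ Opt \ S, c v := (Finset.mul_sum _ _ _).symm
    _ ≤ r * B := by
      refine mul_le_mul_of_nonneg_left (le_trans ?_ hOptc) hr0
      exact Finset.sum_le_sum_of_subset_of_nonneg Finset.sdiff_subset fun v _ _ => (hc v).le
  rw [hgain, ge_iff_le, div_mul_eq_mul_div, div_le_iff₀ hB, mul_assoc]
  exact mul_le_mul_of_nonneg_left hgap (hc vstar).le
end

section
/- Let V be a finite set, f : Finset V → ℝ a set function with f(∅) ≥ 0, c : V → ℝ a cost function, B > 0, and Opt ⊆ V with f(Opt) ≥ 0. Let v_1, …, v_l be distinct elements of V with S_0 = ∅ and S_i = S_{i−1} ∪ {v_i}, and suppose 0 ≤ c(v_i) ≤ B and f(S_i) − f(S_{i−1}) ≥ ( c(v_i) / B ) · ( f(Opt) − f(S_{i−1}) ) for every i = 1,…,l. Then f(S_l) ≥ ( 1 − ∏_{j=1}^{l} ( 1 − c(v_j)/B ) ) · f(Opt). -/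
/-- If every step of `a` closes at least the fraction `t i` of the gap to `M`, then the final gap is
at most `∏ i, (1 - t i)` times the initial one. -/
theorem sub_last_le_prod_mul_sub_zero (M : ℝ) {l : ℕ} (t : Fin l → ℝ) (a : Fin (l + 1) → ℝ)
    (ht : ∀ i, t i ≤ 1)
    (ha : ∀ i : Fin l, t i * (M - a i.castSucc) ≤ a i.succ - a i.castSucc) :
    M - a (Fin.last l) ≤ (∏ i, (1 - t i)) * (M - a 0) := by
  induction l with
  | zero => simp
  | succ n ih =>
    have ih' := ih (fun i => t i.castSucc) (fun i => a i.castSucc) (fun i => ht _)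
      (fun i => ha i.castSucc)
    have step := ha (Fin.last n)
    rw [Fin.succ_last] at step
    rw [Fin.prod_univ_castSucc]
    calc M - a (Fin.last (n + 1))
        ≤ (1 - t (Fin.last n)) * (M - a (Fin.last n).castSucc) := by linarith
      _ ≤ (1 - t (Fin.last n)) * ((∏ i : Fin n, (1 - t i.castSucc)) * (M - a 0)) :=
          mul_le_mul_of_nonneg_left ih' (sub_nonneg.2 (ht _))
      _ = _ := by ring

/-- Induction step in the proof of Theorem 2: iterating the per-step greedy
guarantee yields `f(S_l) ≥ (1 - ∏_j (1 - c(v_j)/B)) · f(Opt)`. -/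
theorem greedy_product_bound {V : Type*} [DecidableEq V]
    (f : Finset V → ℝ) (hfe : 0 ≤ f ∅)
    (c : V → ℝ)
    (B : ℝ) (hB : 0 < B)
    (Opt : Finset V) (hOpt : 0 ≤ f Opt)
    (l : ℕ) (v : Fin l → V) (hv : Function.Injective v)
    (S : Fin (l + 1) → Finset V)
    (hS0 : S 0 = ∅)
    (hSstep : ∀ i : Fin l, S i.succ = insert (v i) (S i.castSucc))
    (hc0 : ∀ i : Fin l, 0 ≤ c (v i))
    (hcB : ∀ i : Fin l, c (v i) ≤ B)
    (hgreedy : ∀ i : Fin l,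
      f (S i.succ) - f (S i.castSucc) ≥ (c (v i) / B) * (f Opt - f (S i.castSucc))) :
    f (S (Fin.last l)) ≥ (1 - ∏ j : Fin l, (1 - c (v j) / B)) * f Opt := by
  have ht : ∀ i, c (v i) / B ≤ 1 := fun i => (div_le_one hB).2 (hcB i)
  have gap := sub_last_le_prod_mul_sub_zero (f Opt) (fun i => c (v i) / B) (fun i => f (S i))
    ht hgreedy
  have hP : 0 ≤ ∏ j : Fin l, (1 - c (v j) / B) :=
    Finset.prod_nonneg fun j _ => sub_nonneg.2 (ht j)
  simp only [hS0] at gap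
  linarith [mul_nonneg hP hfe]
end

section
/- Let (Ω, μ) be a probability space and let Y : Ω → 𝒴 and X_1, …, X_n : Ω → 𝒳 be random variables with finite ranges such that X_1, …, X_n are mutually conditionally independent given Y (the joint conditional pmf factorizes: P(X_1=x_1,…,X_n=x_n | Y=y) = ∏_{k=1}^{n} P(X_k=x_k | Y=y) whenever P(Y=y) > 0). Then the set function f(S) = I[X_S : Y] on subsets S of {1,…,n} is submodular: for all S ⊆ S' ⊆ {1,…,n} and k ∉ S', f(S ∪ {k}) − f(S) ≥ f(S' ∪ {k}) − f(S'). -/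
open MeasureTheory

/-- Shannon entropy of a random variable with finite range. -/
noncomputable def shannonEntropy {Ω : Type*} [MeasurableSpace Ω] {𝒳 : Type*} [Fintype 𝒳]
    (μ : Measure Ω) (X : Ω → 𝒳) : ℝ :=
  ∑ x : 𝒳, Real.negMulLog ((μ (X ⁻¹' {x})).toReal)

/-- Conditional Shannon entropy `H[X|Y] = H[X,Y] - H[Y]`. -/
noncomputable def condEntropy' {Ω : Type*} [MeasurableSpace Ω] {𝒳 𝒴 : Type*}
    [Fintype 𝒳] [Fintype 𝒴] (μ : Measure Ω) (X : Ω → 𝒳) (Y : Ω → 𝒴) : ℝ :=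
  shannonEntropy μ (fun ω => (X ω, Y ω)) - shannonEntropy μ Y

/-- Mutual information `I[X:Y] = H[X] - H[X|Y]`. -/
noncomputable def mutualInfo' {Ω : Type*} [MeasurableSpace Ω] {𝒳 𝒴 : Type*}
    [Fintype 𝒳] [Fintype 𝒴] (μ : Measure Ω) (X : Ω → 𝒳) (Y : Ω → 𝒴) : ℝ :=
  shannonEntropy μ X - condEntropy' μ X Y

/-- Probability of an event, as a real number. -/
noncomputable def probOf {Ω : Type*} [MeasurableSpace Ω] (μ : Measure Ω) (A : Set Ω) : ℝ :=
  (μ A).toReal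

/-- Conditional probability `P(A | B)` as a real number (0 if `P(B) = 0`). -/
noncomputable def condProbOf {Ω : Type*} [MeasurableSpace Ω] (μ : Measure Ω) (A B : Set Ω) : ℝ :=
  (μ (A ∩ B)).toReal / (μ B).toReal

section Entropy

variable {Ω α β γ : Type*} [MeasurableSpace Ω] {μ : Measure Ω} {A : Ω → α} {B : Ω → β} {C : Ω → γ}

theorem measureReal_marginals_pos [IsFiniteMeasure μ] {z : α × β × γ}
    (hz : 0 < μ.real ((fun ω => (A ω, B ω, C ω)) ⁻¹' {z})) :
    0 < μ.real (C ⁻¹' {z.2.2}) ∧ 0 < μ.real ((fun ω => (A ω, C ω)) ⁻¹' {(z.1, z.2.2)}) ∧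
      0 < μ.real ((fun ω => (B ω, C ω)) ⁻¹' {z.2}) := by
  refine ⟨hz.trans_le (measureReal_mono ?_), hz.trans_le (measureReal_mono ?_),
    hz.trans_le (measureReal_mono ?_)⟩ <;>
  · rintro ω rfl
    rfl

variable [Fintype γ] [MeasurableSpace γ] [MeasurableSingletonClass γ]

theorem sum_measureReal_preimage_inter [IsFiniteMeasure μ] {Z : Ω → γ} (hZ : Measurable Z)
    (s : Set Ω) : ∑ z, μ.real (Z ⁻¹' {z} ∩ s) = μ.real s := by
  have h := sum_measureReal_preimage_singleton (μ := μ.restrict s) (f := Z) Finset.univ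
    (fun y _ => hZ (measurableSet_singleton y))
  simpa [measureReal_restrict_apply, hZ (measurableSet_singleton _)] using h

variable [Fintype α]

/-- The entropy of a function of `Z` as an average over the values of `Z`. -/
theorem shannonEntropy_comp_eq_sum [IsFiniteMeasure μ] {Z : Ω → γ} (hZ : Measurable Z)
    (f : γ → α) :
    shannonEntropy μ (fun ω => f (Z ω)) =
      -∑ z, μ.real (Z ⁻¹' {z}) * Real.log (μ.real ((fun ω => f (Z ω)) ⁻¹' {f z})) := by
  classical
  have key (x : α) : μ.real ((fun ω => f (Z ω)) ⁻¹' {x}) =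
      ∑ z with f z = x, μ.real (Z ⁻¹' {z}) := by
    rw [sum_measureReal_preimage_singleton _ fun y _ => hZ (measurableSet_singleton y)]
    congr 1
    ext ω
    simp
  simp only [shannonEntropy, ← measureReal_def, Real.negMulLog, neg_mul, Finset.sum_neg_distrib]
  rw [← Finset.sum_fiberwise Finset.univ f]
  congr 1
  refine Finset.sum_congr rfl fun x _ => ?_
  conv_lhs => enter [1]; rw [key x]
  rw [Finset.sum_mul]
  refine Finset.sum_congr rfl fun z hz => ?_
  rw [(Finset.mem_filter.1 hz).2]

theorem shannonEntropy_comp_of_injective [IsFiniteMeasure μ] {Z : Ω → γ} (hZ : Measurable Z)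
    {f : γ → α} (hf : Function.Injective f) :
    shannonEntropy μ (fun ω => f (Z ω)) = shannonEntropy μ Z := by
  have h (z : γ) : (fun ω => f (Z ω)) ⁻¹' {f z} = Z ⁻¹' {z} := by
    ext ω
    simp [hf.eq_iff]
  rw [shannonEntropy_comp_eq_sum hZ f]
  simp [h, shannonEntropy, Real.negMulLog, measureReal_def]

variable [MeasurableSpace α] [MeasurableSingletonClass α]
  [Fintype β] [MeasurableSpace β] [MeasurableSingletonClass β]

/-- Conditional mutual information, written with entropies, as an average log-ratio. -/
theorem shannonEntropy_add_sub_eq_sum [IsFiniteMeasure μ]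
    (hA : Measurable A) (hB : Measurable B) (hC : Measurable C) :
    shannonEntropy μ (fun ω => (A ω, C ω)) + shannonEntropy μ (fun ω => (B ω, C ω)) -
        shannonEntropy μ (fun ω => (A ω, B ω, C ω)) - shannonEntropy μ C =
      ∑ z : α × β × γ, μ.real ((fun ω => (A ω, B ω, C ω)) ⁻¹' {z}) *
        (Real.log (μ.real ((fun ω => (A ω, B ω, C ω)) ⁻¹' {z})) +
          Real.log (μ.real (C ⁻¹' {z.2.2})) -
          Real.log (μ.real ((fun ω => (A ω, C ω)) ⁻¹' {(z.1, z.2.2)})) -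
          Real.log (μ.real ((fun ω => (B ω, C ω)) ⁻¹' {z.2}))) := by
  have hZ : Measurable fun ω => (A ω, B ω, C ω) := hA.prodMk (hB.prodMk hC)
  rw [shannonEntropy_comp_eq_sum hZ fun z => (z.1, z.2.2),
    shannonEntropy_comp_eq_sum hZ fun z => z.2, shannonEntropy_comp_eq_sum hZ fun z => z,
    shannonEntropy_comp_eq_sum hZ fun z => z.2.2]
  simp only [mul_sub, mul_add, Finset.sum_sub_distrib, Finset.sum_add_distrib]
  ring

/-- Strong subadditivity of Shannon entropy. -/
theorem shannonEntropy_submodular [IsProbabilityMeasure μ]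
    (hA : Measurable A) (hB : Measurable B) (hC : Measurable C) :
    shannonEntropy μ (fun ω => (A ω, B ω, C ω)) + shannonEntropy μ C ≤
      shannonEntropy μ (fun ω => (A ω, C ω)) + shannonEntropy μ (fun ω => (B ω, C ω)) := by
  have hZ : Measurable fun ω => (A ω, B ω, C ω) := hA.prodMk (hB.prodMk hC)
  have hAC (a : α) (c : γ) :
      (fun ω => (A ω, C ω)) ⁻¹' {(a, c)} = A ⁻¹' {a} ∩ C ⁻¹' {c} := by
    ext ω
    simp
  have hBC (b : β) (c : γ) :
      (fun ω => (B ω, C ω)) ⁻¹' {(b, c)} = B ⁻¹' {b} ∩ C ⁻¹' {c} := by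
    ext ω
    simp
  have hq : ∑ z : α × β × γ, μ.real ((fun ω => (A ω, C ω)) ⁻¹' {(z.1, z.2.2)}) *
      μ.real ((fun ω => (B ω, C ω)) ⁻¹' {z.2}) / μ.real (C ⁻¹' {z.2.2}) = 1 := by
    simp only [Fintype.sum_prod_type_right, hAC, hBC, ← Finset.sum_div, ← Finset.sum_mul,
      ← Finset.mul_sum, sum_measureReal_preimage_inter hA, sum_measureReal_preimage_inter hB,
      mul_self_div_self]
    simpa using sum_measureReal_preimage_inter (μ := μ) hC Set.univ
  have hp : ∑ z, μ.real ((fun ω => (A ω, B ω, C ω)) ⁻¹' {z}) = 1 := by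
    simpa using sum_measureReal_preimage_inter (μ := μ) hZ Set.univ
  have hle := Finset.sum_le_sum fun (z : α × β × γ) (_ : z ∈ Finset.univ) =>
    show μ.real ((fun ω => (A ω, B ω, C ω)) ⁻¹' {z}) -
        μ.real ((fun ω => (A ω, C ω)) ⁻¹' {(z.1, z.2.2)}) *
          μ.real ((fun ω => (B ω, C ω)) ⁻¹' {z.2}) / μ.real (C ⁻¹' {z.2.2}) ≤
      μ.real ((fun ω => (A ω, B ω, C ω)) ⁻¹' {z}) *
        (Real.log (μ.real ((fun ω => (A ω, B ω, C ω)) ⁻¹' {z})) +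
          Real.log (μ.real (C ⁻¹' {z.2.2})) -
          Real.log (μ.real ((fun ω => (A ω, C ω)) ⁻¹' {(z.1, z.2.2)})) -
          Real.log (μ.real ((fun ω => (B ω, C ω)) ⁻¹' {z.2}))) from by
      rcases (measureReal_nonneg (μ := μ)
        (s := (fun ω => (A ω, B ω, C ω)) ⁻¹' {z})).eq_or_lt with h | h
      · rw [← h, zero_mul, zero_sub, neg_nonpos]
        positivity
      obtain ⟨hc, hac, hbc⟩ := measureReal_marginals_pos h
      generalize μ.real ((fun ω => (A ω, B ω, C ω)) ⁻¹' {z}) = p at *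
      generalize μ.real (C ⁻¹' {z.2.2}) = c at *
      generalize μ.real ((fun ω => (A ω, C ω)) ⁻¹' {(z.1, z.2.2)}) = a at *
      generalize μ.real ((fun ω => (B ω, C ω)) ⁻¹' {z.2}) = b at *
      have hlog := Real.log_le_sub_one_of_pos (show 0 < a * b / (c * p) by positivity)
      rw [Real.log_div (by positivity) (by positivity), Real.log_mul hac.ne' hbc.ne',
        Real.log_mul hc.ne' h.ne'] at hlog
      have hmul : p * (a * b / (c * p)) = a * b / c := by field_simp
      nlinarith [mul_le_mul_of_nonneg_left hlog h.le]
  rw [Finset.sum_sub_distrib, hp, hq, ← shannonEntropy_add_sub_eq_sum hA hB hC] at hle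
  linarith

/-- Equality case of strong subadditivity: `A` and `B` are conditionally independent given `C`. -/
theorem shannonEntropy_add_eq_of_condIndep [IsFiniteMeasure μ]
    (hA : Measurable A) (hB : Measurable B) (hC : Measurable C)
    (h : ∀ z : α × β × γ, μ.real ((fun ω => (A ω, B ω, C ω)) ⁻¹' {z}) * μ.real (C ⁻¹' {z.2.2}) =
      μ.real ((fun ω => (A ω, C ω)) ⁻¹' {(z.1, z.2.2)}) *
        μ.real ((fun ω => (B ω, C ω)) ⁻¹' {z.2})) :
    shannonEntropy μ (fun ω => (A ω, B ω, C ω)) + shannonEntropy μ C =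
      shannonEntropy μ (fun ω => (A ω, C ω)) + shannonEntropy μ (fun ω => (B ω, C ω)) := by
  have hsum := shannonEntropy_add_sub_eq_sum (μ := μ) hA hB hC
  rw [Finset.sum_eq_zero] at hsum
  · linarith
  intro z _
  rcases (measureReal_nonneg (μ := μ)
    (s := (fun ω => (A ω, B ω, C ω)) ⁻¹' {z})).eq_or_lt with hz | hz
  · rw [← hz, zero_mul]
  obtain ⟨hc, hac, hbc⟩ := measureReal_marginals_pos hz
  have hlog := congrArg Real.log (h z)
  rw [Real.log_mul hz.ne' hc.ne', Real.log_mul hac.ne' hbc.ne'] at hlog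
  rw [hlog]
  ring

end Entropy

section NaiveBayes

open ProbabilityTheory

theorem iIndepFun_of_measureReal_forall_eq_prod {Ω ι 𝒳 : Type*} [MeasurableSpace Ω]
    {μ : Measure Ω} [IsProbabilityMeasure μ] [Fintype ι] [Finite 𝒳] [MeasurableSpace 𝒳]
    [MeasurableSingletonClass 𝒳] {X : ι → Ω → 𝒳} (hX : ∀ i, Measurable (X i))
    (h : ∀ x : ι → 𝒳, μ.real {ω | ∀ i, X i ω = x i} = ∏ i, μ.real {ω | X i ω = x i}) :
    iIndepFun X μ := by
  have hmeas : Measurable fun ω i => X i ω := measurable_pi_lambda _ hX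
  have (i : ι) : IsProbabilityMeasure (μ.map (X i)) :=
    Measure.isProbabilityMeasure_map (hX i).aemeasurable
  have := Measure.isProbabilityMeasure_map (μ := μ) hmeas.aemeasurable
  rw [iIndepFun_iff_map_fun_eq_pi_map fun i => (hX i).aemeasurable,
    ext_iff_measureReal_singleton]
  intro x
  rw [map_measureReal_apply hmeas (measurableSet_singleton x)]
  simp only [measureReal_def, Measure.pi_singleton, ENNReal.toReal_prod]
  simp only [← measureReal_def, map_measureReal_apply (hX _) (measurableSet_singleton _)]
  convert h x using 2
  · ext ω
    simp [funext_iff]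
  · rfl

variable {Ω 𝒳 𝒴 ι : Type*} [MeasurableSpace Ω] {μ : Measure Ω} [IsProbabilityMeasure μ]
  [Fintype ι] [DecidableEq ι] [Fintype 𝒳] [Fintype 𝒴]
  [MeasurableSpace 𝒳] [MeasurableSpace 𝒴]
  [MeasurableSingletonClass 𝒳] [MeasurableSingletonClass 𝒴]
  {Y : Ω → 𝒴} {X : ι → Ω → 𝒳}

/-- Under the Naïve Bayes assumption, the entropy of `(X_S, Y)` is modular in `S`. -/
theorem shannonEntropy_insert_of_condIndep (hY : Measurable Y) (hX : ∀ k, Measurable (X k))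
    (hCondIndep : ∀ (y : 𝒴) (x : ι → 𝒳), 0 < probOf μ {ω | Y ω = y} →
      condProbOf μ {ω | ∀ k, X k ω = x k} {ω | Y ω = y} =
        ∏ k, condProbOf μ {ω | X k ω = x k} {ω | Y ω = y})
    {S : Finset ι} {k : ι} (hk : k ∉ S) :
    shannonEntropy μ (fun ω => (X k ω, (fun u : S => X u ω), Y ω)) + shannonEntropy μ Y =
      shannonEntropy μ (fun ω => (X k ω, Y ω)) +
        shannonEntropy μ (fun ω => ((fun u : S => X u ω), Y ω)) := by
  refine shannonEntropy_add_eq_of_condIndep (hX k) (measurable_pi_lambda _ fun u => hX u) hY ?_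
  rintro ⟨a, b, y⟩
  have hYy : MeasurableSet (Y ⁻¹' {y}) := hY (measurableSet_singleton y)
  have hAC : (fun ω => (X k ω, Y ω)) ⁻¹' {(a, y)} = Y ⁻¹' {y} ∩ X k ⁻¹' {a} := by
    ext ω
    simp [and_comm]
  have hBC : (fun ω => ((fun u : S => X u ω), Y ω)) ⁻¹' {(b, y)} =
      Y ⁻¹' {y} ∩ (fun ω (u : S) => X u ω) ⁻¹' {b} := by
    ext ω
    simp [and_comm]
  have hABC : (fun ω => (X k ω, (fun u : S => X u ω), Y ω)) ⁻¹' {(a, b, y)} =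
      Y ⁻¹' {y} ∩ (X k ⁻¹' {a} ∩ (fun ω (u : S) => X u ω) ⁻¹' {b}) := by
    ext ω
    simp only [Set.mem_preimage, Set.mem_singleton_iff, Prod.mk.injEq, Set.mem_inter_iff]
    tauto
  simp only [hAC, hBC, hABC]
  rcases (measureReal_nonneg (μ := μ) (s := Y ⁻¹' {y})).eq_or_lt with h0 | hpos
  · have (t : Set Ω) : μ.real (Y ⁻¹' {y} ∩ t) = 0 :=
      measureReal_mono_null Set.inter_subset_left h0.symm
    simp [this]
  have : IsProbabilityMeasure μ[|Y ⁻¹' {y}] :=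
    cond_isProbabilityMeasure fun h => by simp [measureReal_def, h] at hpos
  have hcond (t : Set Ω) :
      (μ[|Y ⁻¹' {y}]).real t = μ.real (Y ⁻¹' {y} ∩ t) / μ.real (Y ⁻¹' {y}) := by
    rw [measureReal_def, cond_apply hYy, ENNReal.toReal_mul, ENNReal.toReal_inv, div_eq_inv_mul]
    rfl
  have hindep : iIndepFun X μ[|Y ⁻¹' {y}] := by
    refine iIndepFun_of_measureReal_forall_eq_prod hX fun x => ?_
    simp only [hcond, Set.inter_comm (Y ⁻¹' {y})]
    exact hCondIndep y x hpos
  have hpair : IndepFun (X k) (fun ω (u : S) => X u ω) μ[|Y ⁻¹' {y}] :=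
    (hindep.indepFun_finset {k} S (by simpa using hk) hX).comp
      (φ := fun x : ↥({k} : Finset ι) → 𝒳 => x ⟨k, Finset.mem_singleton_self k⟩) (ψ := id)
      (by fun_prop) measurable_id
  have hmul := congrArg ENNReal.toReal (hpair.measure_inter_preimage_eq_mul {a} {b}
    (measurableSet_singleton a) (measurableSet_singleton b))
  rw [ENNReal.toReal_mul] at hmul
  simp only [← measureReal_def, hcond] at hmul
  field_simp at hmul
  linarith

end NaiveBayes

theorem injective_restrict_insert {ι 𝒳 : Type*} [DecidableEq ι] (S : Finset ι) (k : ι) :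
    Function.Injective fun x : ↥(insert k S) → 𝒳 =>
      (x ⟨k, Finset.mem_insert_self k S⟩,
        fun u : S => x ⟨u, Finset.mem_insert_of_mem u.2⟩) := by
  intro x x' h
  obtain ⟨hk, hS⟩ := Prod.mk.injEq .. ▸ h
  funext ⟨u, hu⟩
  rcases Finset.mem_insert.1 hu with rfl | hu
  · exact hk
  · exact congrFun hS ⟨u, hu⟩

/-- Submodularity of information gain under the Naïve Bayes assumption:
if `X_1, …, X_n` are mutually conditionally independent given `Y`, then
`S ↦ I[X_S : Y]` is submodular. -/
theorem naive_bayes_info_gain_submodular {Ω : Type*} [MeasurableSpace Ω]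
    (μ : Measure Ω) [IsProbabilityMeasure μ]
    {𝒳 𝒴 : Type*} [Fintype 𝒳] [Fintype 𝒴]
    [MeasurableSpace 𝒳] [MeasurableSpace 𝒴]
    [MeasurableSingletonClass 𝒳] [MeasurableSingletonClass 𝒴]
    (n : ℕ) (Y : Ω → 𝒴) (X : Fin n → Ω → 𝒳)
    (hY : Measurable Y) (hX : ∀ k : Fin n, Measurable (X k))
    (hCondIndep : ∀ (y : 𝒴) (x : Fin n → 𝒳), 0 < probOf μ {ω | Y ω = y} →
      condProbOf μ {ω | ∀ k : Fin n, X k ω = x k} {ω | Y ω = y} =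
        ∏ k : Fin n, condProbOf μ {ω | X k ω = x k} {ω | Y ω = y}) :
    ∀ (S S' : Finset (Fin n)) (k : Fin n), S ⊆ S' → k ∉ S' →
      mutualInfo' μ (fun ω => fun u : (insert k S : Finset (Fin n)) => X u ω) Y -
          mutualInfo' μ (fun ω => fun u : S => X u ω) Y ≥
        mutualInfo' μ (fun ω => fun u : (insert k S' : Finset (Fin n)) => X u ω) Y -
          mutualInfo' μ (fun ω => fun u : S' => X u ω) Y := by
  intro S S' k hSS' hk
  have hXS (T : Finset (Fin n)) : Measurable fun ω (u : T) => X u ω :=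
    measurable_pi_lambda _ fun u => hX u
  have hins (T : Finset (Fin n)) :
      shannonEntropy μ (fun ω => (X k ω, fun u : T => X u ω)) =
        shannonEntropy μ (fun ω (u : (insert k T : Finset (Fin n))) => X u ω) :=
    shannonEntropy_comp_of_injective (hXS (insert k T)) (injective_restrict_insert T k)
  have hinsY (T : Finset (Fin n)) :
      shannonEntropy μ (fun ω => (X k ω, (fun u : T => X u ω), Y ω)) =
        shannonEntropy μ
          (fun ω => ((fun u : (insert k T : Finset (Fin n)) => X u ω), Y ω)) :=
    shannonEntropy_comp_of_injective ((hXS (insert k T)).prodMk hY)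
      (f := fun x => (x.1 ⟨k, Finset.mem_insert_self k T⟩,
        (fun u : T => x.1 ⟨u, Finset.mem_insert_of_mem u.2⟩), x.2))
      ((Equiv.prodAssoc _ _ _).injective.comp
        ((injective_restrict_insert T k).prodMap Function.injective_id))
  have hdup : shannonEntropy μ (fun ω => ((fun u : S' => X u ω), fun u : S => X u ω)) =
      shannonEntropy μ (fun ω (u : S') => X u ω) :=
    shannonEntropy_comp_of_injective (hXS S')
      (f := fun x => (x, fun u : S => x ⟨u, hSS' u.2⟩)) fun _ _ h => congrArg Prod.fst h
  have hdup' : shannonEntropy μ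
        (fun ω => (X k ω, (fun u : S' => X u ω), fun u : S => X u ω)) =
      shannonEntropy μ (fun ω => (X k ω, fun u : S' => X u ω)) :=
    shannonEntropy_comp_of_injective ((hX k).prodMk (hXS S'))
      (f := fun x => (x.1, x.2, fun u : S => x.2 ⟨u, hSS' u.2⟩)) fun _ _ h =>
        Prod.ext (Prod.mk.inj h).1 (Prod.mk.inj (Prod.mk.inj h).2).1
  have hsub := shannonEntropy_submodular (μ := μ) (hX k) (hXS S') (hXS S)
  rw [hdup, hdup', hins, hins] at hsub
  have hmod := shannonEntropy_insert_of_condIndep hY hX hCondIndep fun h => hk (hSS' h)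
  have hmod' := shannonEntropy_insert_of_condIndep hY hX hCondIndep hk
  rw [hinsY] at hmod hmod'
  simp only [mutualInfo', condEntropy']
  linarith
end
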